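/- Let A be a reduced commutative subring of a commutative ring B, and let C be the subring of B generated by A together with the idempotents of B. Then the map α̃ ↦ (supp(α̃), α̃ ∩ A) is a bijection from the set of prime cones of C onto the set of pairs (p, α) where p is a prime ideal of C, α is a prime cone of A, and p ∩ A = supp(α). -/

import Mathlib

/-- A prime ideal of the subring `S` of a commutative ring `R`, encoded as a subset
`p ⊆ S`: it contains `0`, is closed under addition and multiplication by elements of
`S`, is proper (`1 ∉ p`), and is prime. -/
def IsPrimeIdealOn {R : Type*} [CommRing R] (S : Subring R) (p : Set R) : Prop :=
  p ⊆ ↑S ∧ (0 : R) ∈ p ∧ (∀ x ∈ p, ∀ y ∈ p, x + y ∈ p) ∧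
    (∀ x ∈ S, ∀ y ∈ p, x * y ∈ p) ∧ (1 : R) ∉ p ∧
    ∀ x ∈ S, ∀ y ∈ S, x * y ∈ p → x ∈ p ∨ y ∈ p

/-- A prime cone of the subring `S` of a commutative ring `R`, encoded as a subset
`α ⊆ S`: `α + α ⊆ α`, `α·α ⊆ α`, `x² ∈ α` for all `x ∈ S`, `α ∪ (−α) = S`, and the
support `α ∩ (−α)` is a prime ideal of `S`. -/
def IsPrimeConeOn {R : Type*} [CommRing R] (S : Subring R) (α : Set R) : Prop :=
  α ⊆ ↑S ∧ (∀ x ∈ α, ∀ y ∈ α, x + y ∈ α) ∧ (∀ x ∈ α, ∀ y ∈ α, x * y ∈ α) ∧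
    (∀ x ∈ S, x ^ 2 ∈ α) ∧ (∀ x ∈ S, x ∈ α ∨ -x ∈ α) ∧
    IsPrimeIdealOn S {x | x ∈ α ∧ -x ∈ α}

section PrimeCones

variable {R : Type*} [CommRing R] {S T : Subring R} {p α β : Set R}

theorem IsPrimeIdealOn.neg_mem (hp : IsPrimeIdealOn S p) {x : R} (hx : x ∈ p) : -x ∈ p := by
  simpa using hp.2.2.2.1 (-1) (S.neg_mem S.one_mem) x hx

theorem IsPrimeIdealOn.sub_mem (hp : IsPrimeIdealOn S p) {x y : R} (hx : x ∈ p) (hy : y ∈ p) :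
    x - y ∈ p := by
  rw [sub_eq_add_neg]
  exact hp.2.2.1 _ hx _ (hp.neg_mem hy)

theorem IsPrimeIdealOn.inter (hp : IsPrimeIdealOn T p) (hST : S ≤ T) :
    IsPrimeIdealOn S (p ∩ S) := by
  obtain ⟨-, h0, hadd, hmul, h1, hprime⟩ := hp
  refine ⟨Set.inter_subset_right, ⟨h0, S.zero_mem⟩,
    fun x hx y hy => ⟨hadd x hx.1 y hy.1, S.add_mem hx.2 hy.2⟩,
    fun x hx y hy => ⟨hmul x (hST hx) y hy.1, S.mul_mem hx hy.2⟩, fun h => h1 h.1,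
    fun x hx y hy h => ?_⟩
  exact (hprime x (hST hx) y (hST hy) h.1).imp (fun h => ⟨h, hx⟩) (fun h => ⟨h, hy⟩)

theorem support_inter (S : Subring R) (β : Set R) :
    {x | x ∈ β ∧ -x ∈ β} ∩ (S : Set R) = {x | x ∈ β ∩ S ∧ -x ∈ β ∩ S} := by
  ext x
  simp only [Set.mem_inter_iff, Set.mem_ofPred_eq, SetLike.mem_coe, neg_mem_iff]
  tauto

theorem IsPrimeConeOn.inter (hβ : IsPrimeConeOn T β) (hST : S ≤ T) :
    IsPrimeConeOn S (β ∩ S) := by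
  obtain ⟨-, hadd, hmul, hsq, htot, hsupp⟩ := hβ
  refine ⟨Set.inter_subset_right, fun x hx y hy => ⟨hadd x hx.1 y hy.1, S.add_mem hx.2 hy.2⟩,
    fun x hx y hy => ⟨hmul x hx.1 y hy.1, S.mul_mem hx.2 hy.2⟩,
    fun x hx => ⟨hsq x (hST hx), S.pow_mem hx 2⟩,
    fun x hx => (htot x (hST hx)).imp (fun h => ⟨h, hx⟩) (fun h => ⟨h, S.neg_mem hx⟩), ?_⟩
  rw [← support_inter]
  exact hsupp.inter hST

/-- If the subring `S` surjects onto `T` modulo the support, then a prime cone of `T` is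
determined by its support and its trace on `S`. -/
theorem IsPrimeConeOn.subset_of_inter_subset {γ : Set R} (hβ : IsPrimeConeOn T β)
    (hγ : IsPrimeConeOn T γ)
    (hres : ∀ c ∈ T, ∃ a ∈ S, c - a ∈ {x | x ∈ β ∧ -x ∈ β})
    (hsupp : {x | x ∈ β ∧ -x ∈ β} ⊆ {x | x ∈ γ ∧ -x ∈ γ}) (h : β ∩ S ⊆ γ ∩ S) : β ⊆ γ := by
  intro x hx
  obtain ⟨a, ha, hxa⟩ := hres x (hβ.1 hx)
  have haβ : a ∈ β := by
    convert hβ.2.1 x hx _ hxa.2 using 1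
    ring
  convert hγ.2.1 a (h ⟨haβ, ha⟩).1 _ (hsupp hxa).1 using 1
  ring

/-- The elements of `T` congruent modulo `p` to an element of `α`. -/
def coneExtension (T : Subring R) (p α : Set R) : Set R :=
  {c | c ∈ T ∧ ∃ a ∈ α, c - a ∈ p}

theorem mem_of_mem_coneExtension (hp : IsPrimeIdealOn T p)
    (hα : IsPrimeConeOn S α) (hpα : p ∩ S = {x | x ∈ α ∧ -x ∈ α}) {c a : R}
    (hc : c ∈ coneExtension T p α) (ha : a ∈ S) (hca : c - a ∈ p) : a ∈ α := by
  obtain ⟨-, b, hb, hcb⟩ := hc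
  have hab : a - b ∈ p ∩ S := by
    refine ⟨?_, S.sub_mem ha (hα.1 hb)⟩
    convert hp.sub_mem hcb hca using 1
    ring
  rw [hpα] at hab
  simpa using hα.2.1 _ hab.1 b hb

theorem coneExtension_inter (hST : S ≤ T) (hp : IsPrimeIdealOn T p)
    (hα : IsPrimeConeOn S α) (hpα : p ∩ S = {x | x ∈ α ∧ -x ∈ α}) :
    coneExtension T p α ∩ S = α := by
  have h0 (x : R) : x - x ∈ p := by simpa using hp.2.1
  ext x
  exact ⟨fun h => mem_of_mem_coneExtension hp hα hpα h.1 h.2 (h0 x),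
    fun h => ⟨⟨hST (hα.1 h), x, h, h0 x⟩, hα.1 h⟩⟩

theorem support_coneExtension (hp : IsPrimeIdealOn T p)
    (hα : IsPrimeConeOn S α) (hpα : p ∩ S = {x | x ∈ α ∧ -x ∈ α}) :
    {x | x ∈ coneExtension T p α ∧ -x ∈ coneExtension T p α} = p := by
  have h0 : (0 : R) ∈ α := hα.2.2.2.2.2.2.1.1
  ext x
  constructor
  · rintro ⟨⟨-, a, ha, hxa⟩, -, b, hb, hxb⟩
    have hab : a + b ∈ p ∩ S := by
      refine ⟨?_, S.add_mem (hα.1 ha) (hα.1 hb)⟩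
      convert hp.neg_mem (hp.2.2.1 _ hxa _ hxb) using 1
      ring
    rw [hpα] at hab
    have hna : -a ∈ α := by
      convert hα.2.1 b hb _ hab.2 using 1
      ring
    have hap : a ∈ p ∩ S := by
      rw [hpα]
      exact ⟨ha, hna⟩
    simpa using hp.2.2.1 _ hxa a hap.1
  · intro hx
    exact ⟨⟨hp.1 hx, 0, h0, by simpa using hx⟩,
      T.neg_mem (hp.1 hx), 0, h0, by simpa using hp.neg_mem hx⟩

theorem isPrimeConeOn_coneExtension (hST : S ≤ T) (hp : IsPrimeIdealOn T p)
    (hα : IsPrimeConeOn S α) (hpα : p ∩ S = {x | x ∈ α ∧ -x ∈ α})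
    (hres : ∀ c ∈ T, ∃ a ∈ S, c - a ∈ p) : IsPrimeConeOn T (coneExtension T p α) := by
  have hsupp := support_coneExtension hp hα hpα
  obtain ⟨hαS, hadd, hmul, hsq, htot, -⟩ := hα
  refine ⟨fun x hx => hx.1, ?_, ?_, ?_, ?_, by rwa [hsupp]⟩
  · rintro x ⟨hx, a, ha, hxa⟩ y ⟨hy, b, hb, hyb⟩
    refine ⟨T.add_mem hx hy, a + b, hadd a ha b hb, ?_⟩
    convert hp.2.2.1 _ hxa _ hyb using 1
    ring
  · rintro x ⟨hx, a, ha, hxa⟩ y ⟨hy, b, hb, hyb⟩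
    refine ⟨T.mul_mem hx hy, a * b, hmul a ha b hb, ?_⟩
    convert hp.2.2.1 _ (hp.2.2.2.1 y hy _ hxa) _ (hp.2.2.2.1 a (hST (hαS ha)) _ hyb) using 1
    ring
  · intro x hx
    obtain ⟨a, ha, hxa⟩ := hres x hx
    refine ⟨T.pow_mem hx 2, a ^ 2, hsq a ha, ?_⟩
    convert hp.2.2.2.1 (x + a) (T.add_mem hx (hST ha)) _ hxa using 1
    ring
  · intro x hx
    obtain ⟨a, ha, hxa⟩ := hres x hx
    refine (htot a ha).imp (fun h => ⟨hx, a, h, hxa⟩) (fun h => ⟨T.neg_mem hx, -a, h, ?_⟩)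
    convert hp.neg_mem hxa using 1
    ring

/-- Modulo a prime ideal every idempotent becomes `0` or `1`, so adjoining idempotents to `A`
does not enlarge its image in the quotient. -/
theorem exists_sub_mem_of_mem_closure_idempotents {A : Subring R}
    (hp : IsPrimeIdealOn (Subring.closure ((A : Set R) ∪ {e : R | e * e = e})) p) {c : R}
    (hc : c ∈ Subring.closure ((A : Set R) ∪ {e : R | e * e = e})) :
    ∃ a ∈ A, c - a ∈ p := by
  have hsub : A ≤ Subring.closure ((A : Set R) ∪ {e : R | e * e = e}) :=
    fun x hx => Subring.subset_closure (Or.inl hx)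
  induction hc using Subring.closure_induction with
  | mem x hx =>
    have hxC := Subring.subset_closure hx
    rcases hx with hx | hx
    · exact ⟨x, hx, by simpa using hp.2.1⟩
    · have h : x * (x - 1) ∈ p := by
        rw [mul_sub, show x * x = x from hx, mul_one, sub_self]
        exact hp.2.1
      rcases hp.2.2.2.2.2 x hxC (x - 1) (Subring.sub_mem _ hxC (Subring.one_mem _)) h with h | h
      · exact ⟨0, A.zero_mem, by simpa using h⟩
      · exact ⟨1, A.one_mem, h⟩
  | zero => exact ⟨0, A.zero_mem, by simpa using hp.2.1⟩
  | one => exact ⟨1, A.one_mem, by simpa using hp.2.1⟩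
  | add x y _ _ hx hy =>
    obtain ⟨a, ha, hxa⟩ := hx
    obtain ⟨b, hb, hyb⟩ := hy
    refine ⟨a + b, A.add_mem ha hb, ?_⟩
    convert hp.2.2.1 _ hxa _ hyb using 1
    ring
  | neg x _ hx =>
    obtain ⟨a, ha, hxa⟩ := hx
    refine ⟨-a, A.neg_mem ha, ?_⟩
    convert hp.neg_mem hxa using 1
    ring
  | mul x y _ hyC hx hy =>
    obtain ⟨a, ha, hxa⟩ := hx
    obtain ⟨b, hb, hyb⟩ := hy
    refine ⟨a * b, A.mul_mem ha hb, ?_⟩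
    convert hp.2.2.1 _ (hp.2.2.2.1 y hyC _ hxa) _ (hp.2.2.2.1 a (hsub ha) _ hyb) using 1
    ring

end PrimeCones

/-- Let `A` be a reduced commutative subring of a commutative ring `B` and `C` the
subring of `B` generated by `A` together with the idempotents of `B`.  Then
`α̃ ↦ (supp α̃, α̃ ∩ A)` is a bijection from the prime cones of `C` onto the pairs
`(p, α)` where `p` is a prime ideal of `C`, `α` is a prime cone of `A`, and
`p ∩ A = supp α`.  (This is the set-theoretic content of the homeomorphism
`Sper C ≅ Spec C ×_{Spec A} Sper A`.) -/
theorem primeCones_bijOn_fiberProduct {B : Type*} [CommRing B] (A : Subring B)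
    [IsReduced ↥A] :
    Set.BijOn
      (fun β : Set B => (({x | x ∈ β ∧ -x ∈ β} : Set B), β ∩ ↑A))
      {β : Set B |
        IsPrimeConeOn (Subring.closure ((A : Set B) ∪ {e : B | e * e = e})) β}
      {pa : Set B × Set B |
        IsPrimeIdealOn (Subring.closure ((A : Set B) ∪ {e : B | e * e = e})) pa.1 ∧
          IsPrimeConeOn A pa.2 ∧ pa.1 ∩ ↑A = {x | x ∈ pa.2 ∧ -x ∈ pa.2}} := by
  have hsub : A ≤ Subring.closure ((A : Set B) ∪ {e : B | e * e = e}) :=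
    fun x hx => Subring.subset_closure (Or.inl hx)
  refine ⟨fun β hβ => ⟨hβ.2.2.2.2.2, hβ.inter hsub, support_inter A β⟩, ?_, ?_⟩
  · intro β hβ γ hγ h
    obtain ⟨hsupp, htrace⟩ := Prod.mk.inj h
    exact (hβ.subset_of_inter_subset hγ
      (fun _ => exists_sub_mem_of_mem_closure_idempotents hβ.2.2.2.2.2)
      hsupp.subset htrace.subset).antisymm (hγ.subset_of_inter_subset hβ
      (fun _ => exists_sub_mem_of_mem_closure_idempotents hγ.2.2.2.2.2)
      hsupp.symm.subset htrace.symm.subset)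
  · rintro ⟨p, α⟩ ⟨hp, hα, hpα⟩
    exact ⟨coneExtension _ p α, isPrimeConeOn_coneExtension hsub hp hα hpα
      (fun _ => exists_sub_mem_of_mem_closure_idempotents hp),
      Prod.ext (support_coneExtension hp hα hpα) (coneExtension_inter hsub hp hα hpα)⟩
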